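/- Let p be a prime, n ≥ 1 an integer, and d = p^{n+1} − p^n. Let g be a monic polynomial of degree d in the variable a over the power series ring F_p[[u]], such that every coefficient of g of degree strictly less than d is divisible by u and the constant coefficient of g is not divisible by u². Let m denote the maximal ideal of the local ring F_p[[u]][a]/(g). Then the image of u in F_p[[u]][a]/(g) lies in m^d but not in m^{d+1}; that is, u has valuation exactly d = p^{n+1} − p^n in this discrete valuation ring. -/

import Mathlib

namespace Polynomial.IsEisensteinAt

open IsLocalRing

variable {A : Type*} [CommRing A] [IsLocalRing A] {g : A[X]}

theorem of_mem_of_isMaximal (hg : g.Monic) {m : Ideal (AdjoinRoot g)} (hm : m.IsMaximal)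
    {x : A} (hx : x ∈ maximalIdeal A) : AdjoinRoot.of g x ∈ m := by
  have : Module.Finite A (AdjoinRoot g) := hg.finite_adjoinRoot
  have h : (m.comap (algebraMap A (AdjoinRoot g))).IsMaximal :=
    Ideal.isMaximal_comap_of_isIntegral_of_isMaximal m
  rw [← eq_maximalIdeal h] at hx
  exact hx

theorem root_mem_of_isMaximal (hE : g.IsEisensteinAt (maximalIdeal A)) (hg : g.Monic)
    {m : Ideal (AdjoinRoot g)} (hm : m.IsMaximal) : AdjoinRoot.root g ∈ m := by
  have hroot : g.eval₂ (AdjoinRoot.of g) (AdjoinRoot.root g) = 0 := AdjoinRoot.eval₂_root g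
  rw [eval₂_eq_sum_range, Finset.sum_range_succ, hg.coeff_natDegree, map_one, one_mul] at hroot
  refine hm.isPrime.mem_of_pow_mem g.natDegree ?_
  rw [eq_neg_of_add_eq_zero_right hroot]
  refine m.neg_mem (m.sum_mem fun i hi => m.mul_mem_right _ ?_)
  exact of_mem_of_isMaximal hg hm (hE.mem (Finset.mem_range.mp hi))

theorem mk_mem_iff_of_isMaximal (hE : g.IsEisensteinAt (maximalIdeal A)) (hg : g.Monic)
    {m : Ideal (AdjoinRoot g)} (hm : m.IsMaximal) (f : A[X]) :
    AdjoinRoot.mk g f ∈ m ↔ f.coeff 0 ∈ maximalIdeal A := by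
  have hf : AdjoinRoot.mk g f =
      AdjoinRoot.root g * AdjoinRoot.mk g f.divX + AdjoinRoot.of g (f.coeff 0) := by
    conv_lhs => rw [← X_mul_divX_add f]
    rw [map_add, map_mul, AdjoinRoot.mk_X, AdjoinRoot.mk_C]
  rw [hf, m.add_mem_iff_right (m.mul_mem_right _ (root_mem_of_isMaximal hE hg hm))]
  refine ⟨fun h hu => hm.ne_top (m.eq_top_of_isUnit_mem h ?_), of_mem_of_isMaximal hg hm⟩
  exact hu.map _

theorem isUnit_mk (hE : g.IsEisensteinAt (maximalIdeal A)) (hg : g.Monic) {f : A[X]}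
    (hf : IsUnit (f.coeff 0)) : IsUnit (AdjoinRoot.mk g f) := by
  by_contra h
  obtain ⟨m, hm, hmem⟩ := exists_max_ideal_of_mem_nonunits h
  exact (mk_mem_iff_of_isMaximal hE hg hm f).mp hmem hf

/-- The root of an Eisenstein polynomial is a uniformizer whose `natDegree`-th power is
associated to the uniformizer of the base. -/
theorem associated_root_pow (hE : g.IsEisensteinAt (maximalIdeal A)) (hg : g.Monic)
    (hd : g.natDegree ≠ 0) {ϖ : A} (hϖ : maximalIdeal A = Ideal.span {ϖ}) :
    Associated (AdjoinRoot.of g ϖ) (AdjoinRoot.root g ^ g.natDegree) := by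
  obtain ⟨h, hh⟩ : C ϖ ∣ X ^ g.natDegree - g := by
    rw [C_dvd_iff_dvd_coeff]
    intro i
    rw [coeff_sub, coeff_X_pow]
    rcases lt_trichotomy i g.natDegree with hi | hi | hi
    · have := hE.mem hi
      rw [hϖ, Ideal.mem_span_singleton] at this
      simpa [hi.ne] using this
    · simp [hi, hg.coeff_natDegree]
    · simp [hi.ne', coeff_eq_zero_of_natDegree_lt hi]
  have h0 : IsUnit (h.coeff 0) := by
    by_contra hu
    have hmem : h.coeff 0 ∈ maximalIdeal A := hu
    have hϖm : ϖ ∈ maximalIdeal A := hϖ ▸ Ideal.mem_span_singleton_self ϖ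
    have hc : g.coeff 0 = -(ϖ * h.coeff 0) := by
      have := congrArg (coeff · 0) hh
      simp only [coeff_sub, coeff_X_pow, hd.symm, if_false, coeff_C_mul, zero_sub] at this
      rw [← this, neg_neg]
    refine hE.notMem ?_
    rw [hc, pow_two]
    exact neg_mem (Ideal.mul_mem_mul hϖm hmem)
  refine (associated_mul_unit_right _ _ (isUnit_mk hE hg h0)).trans (Associated.of_eq ?_)
  have := congrArg (AdjoinRoot.mk g) hh
  simpa using this.symm

theorem eq_span_root_of_isMaximal (hE : g.IsEisensteinAt (maximalIdeal A)) (hg : g.Monic)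
    (hd : g.natDegree ≠ 0) {ϖ : A} (hϖ : maximalIdeal A = Ideal.span {ϖ})
    {m : Ideal (AdjoinRoot g)} (hm : m.IsMaximal) : m = Ideal.span {AdjoinRoot.root g} := by
  refine le_antisymm (fun x hx => ?_) ?_
  · obtain ⟨f, rfl⟩ := AdjoinRoot.mk_surjective x
    rw [mk_mem_iff_of_isMaximal hE hg hm, hϖ, Ideal.mem_span_singleton] at hx
    rw [Ideal.mem_span_singleton, ← X_mul_divX_add f, map_add, map_mul, AdjoinRoot.mk_X,
      AdjoinRoot.mk_C]
    refine dvd_add (dvd_mul_right _ _) (Dvd.dvd.trans ?_ (_root_.map_dvd (AdjoinRoot.of g) hx))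
    exact (dvd_pow_self _ hd).trans (associated_root_pow hE hg hd hϖ).dvd'
  · rw [Ideal.span_singleton_le_iff_mem]
    exact root_mem_of_isMaximal hE hg hm

theorem of_mem_pow_and_notMem_pow_succ (hE : g.IsEisensteinAt (maximalIdeal A)) (hg : g.Monic)
    (hd : g.natDegree ≠ 0) {ϖ : A} (hϖ : maximalIdeal A = Ideal.span {ϖ}) (hϖ0 : ϖ ≠ 0)
    {m : Ideal (AdjoinRoot g)} (hm : m.IsMaximal) :
    AdjoinRoot.of g ϖ ∈ m ^ g.natDegree ∧ AdjoinRoot.of g ϖ ∉ m ^ (g.natDegree + 1) := by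
  have hassoc := associated_root_pow hE hg hd hϖ
  rw [eq_span_root_of_isMaximal hE hg hd hϖ hm, Ideal.span_singleton_pow,
    Ideal.span_singleton_pow, Ideal.mem_span_singleton, Ideal.mem_span_singleton]
  refine ⟨hassoc.dvd', fun hdvd => ?_⟩
  obtain ⟨r, hr⟩ := hdvd.trans hassoc.dvd
  obtain ⟨f, rfl⟩ := AdjoinRoot.mk_surjective r
  have hunit : IsUnit (AdjoinRoot.mk g (1 - X * f)) := isUnit_mk hE hg (by simp)
  have hpow : AdjoinRoot.root g ^ g.natDegree = 0 := by
    rw [← hunit.mul_left_eq_zero, map_sub, map_one, map_mul, AdjoinRoot.mk_X, mul_sub, mul_one,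
      sub_eq_zero, ← mul_assoc, ← pow_succ]
    exact hr
  rw [hpow, associated_zero_iff_eq_zero] at hassoc
  rw [← AdjoinRoot.mk_C, AdjoinRoot.mk_eq_zero] at hassoc
  exact hg.not_dvd_of_natDegree_lt (C_ne_zero.mpr hϖ0)
    (by rw [natDegree_C]; exact Nat.pos_of_ne_zero hd) hassoc

end Polynomial.IsEisensteinAt

/-- Let `p` be a prime, `n ≥ 1` an integer, and `d = p^{n+1} - p^n`.  Let `g` be a monic
polynomial of degree `d` in the variable `a` over the power series ring `𝔽_p[[u]]`
(with `u = PowerSeries.X`), such that every coefficient of `g` of degree strictly less than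
`d` is divisible by `u` and the constant coefficient of `g` is not divisible by `u²`.
Let `m` denote the maximal ideal of the local ring `𝔽_p[[u]][a]/(g)` (stated by quantifying
over all maximal ideals, which is equivalent since the quotient is local).  Then the image of
`u` in `𝔽_p[[u]][a]/(g)` lies in `m^d` but not in `m^{d+1}`; that is, `u` has valuation
exactly `d = p^{n+1} - p^n` in this discrete valuation ring. -/
theorem u_valuation_eq_d (p : ℕ) (hp : p.Prime) (n : ℕ) (hn : 1 ≤ n)
    (g : Polynomial (PowerSeries (ZMod p)))
    (hmonic : g.Monic) (hdeg : g.natDegree = p ^ (n + 1) - p ^ n)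
    (hcoeff : ∀ i < p ^ (n + 1) - p ^ n, (PowerSeries.X : PowerSeries (ZMod p)) ∣ g.coeff i)
    (hconst : ¬ (PowerSeries.X : PowerSeries (ZMod p)) ^ 2 ∣ g.coeff 0) :
    ∀ m : Ideal (Polynomial (PowerSeries (ZMod p)) ⧸ Ideal.span {g}), m.IsMaximal →
      Ideal.Quotient.mk (Ideal.span {g}) (Polynomial.C (PowerSeries.X : PowerSeries (ZMod p)))
          ∈ m ^ (p ^ (n + 1) - p ^ n) ∧
      Ideal.Quotient.mk (Ideal.span {g}) (Polynomial.C (PowerSeries.X : PowerSeries (ZMod p)))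
          ∉ m ^ (p ^ (n + 1) - p ^ n + 1) := by
  have : Fact p.Prime := ⟨hp⟩
  have hd : p ^ (n + 1) - p ^ n ≠ 0 :=
    (Nat.sub_pos_of_lt (Nat.pow_lt_pow_right hp.one_lt n.lt_succ_self)).ne'
  have hX : IsLocalRing.maximalIdeal (PowerSeries (ZMod p)) =
      Ideal.span {(PowerSeries.X : PowerSeries (ZMod p))} :=
    PowerSeries.maximalIdeal_eq_span_X
  have hE : g.IsEisensteinAt (IsLocalRing.maximalIdeal (PowerSeries (ZMod p))) := by
    refine ⟨?_, fun {i} hi => ?_, ?_⟩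
    · rw [hmonic.leadingCoeff]
      exact fun h => h isUnit_one
    · rw [hX, Ideal.mem_span_singleton]
      exact hcoeff i (hdeg ▸ hi)
    · rwa [hX, Ideal.span_singleton_pow, Ideal.mem_span_singleton]
  rw [← hdeg] at hd ⊢
  intro m hm
  exact hE.of_mem_pow_and_notMem_pow_succ hmonic hd hX PowerSeries.X_ne_zero hm
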